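/- Let K be an algebraically closed field of characteristic 0, let V be an m-dimensional vector space over K, and let G be a closed subgroup of GL(V) such that the image of the determinant map restricted to G is a finite group (of some order k). Then d(G, V) = m. -/

import Mathlib

open CategoryTheory MonoidalCategory Limits

noncomputable section

universe u

/-- The `n`-th tensor power of a representation, in the category `Rep k G`. -/
def tpow {k G : Type u} [Field k] [Monoid G] (V : Rep k G) : ℕ → Rep k G
  | 0 => 𝟙_ (Rep k G)
  | n + 1 => tpow V n ⊗ V

/-- `TS V` : the number of trivial direct summands of `V`, counted with multiplicity, i.e.
the largest `n` such that the trivial representation on `k^n` is a direct summand of `V`. -/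
def TS {k G : Type u} [Field k] [Monoid G] (V : Rep k G) : ℕ :=
  sSup {n : ℕ | ∃ W : Rep k G, Nonempty (V ≅ Rep.trivial k G (Fin n → k) ⊞ W)}

/-- `dG V = limsup_{n → ∞} TS(V^{⊗n})^(1/n)`. -/
def dG {k G : Type u} [Field k] [Monoid G] (V : Rep k G) : ℝ :=
  Filter.limsup (fun n : ℕ => (TS (tpow V n) : ℝ) ^ ((n : ℝ)⁻¹)) Filter.atTop

/-- The representation on `k^m` induced by a group homomorphism to `GL_m(k)`. -/
def matRep {k G : Type u} [Field k] [Monoid G] {m : ℕ}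
    (ρ : G →* Matrix.GeneralLinearGroup (Fin m) k) : Representation k G (Fin m → k) :=
  (Matrix.toLinAlgEquiv'.toRingEquiv.toRingHom.toMonoidHom).comp
    ((Units.coeHom (Matrix (Fin m) (Fin m) k)).comp ρ)

/-- A subset of `GL_m(k)` is Zariski closed if it is the intersection of `GL_m(k)` with the
zero locus of a set of polynomials in the matrix entries. -/
def IsZariskiClosedGL {k : Type u} [Field k] {m : ℕ}
    (Z : Set (Matrix.GeneralLinearGroup (Fin m) k)) : Prop :=
  ∃ S : Set (MvPolynomial (Fin m × Fin m) k),
    Z = {g : Matrix.GeneralLinearGroup (Fin m) k | ∀ f ∈ S,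
      MvPolynomial.eval (fun q : Fin m × Fin m => (g.val : Matrix (Fin m) (Fin m) k) q.1 q.2) f = 0}

/-- The Zariski closure of a subset of `GL_m(k)`: the smallest Zariski-closed subset
containing it. -/
def zariskiClosure {k : Type u} [Field k] {m : ℕ}
    (X : Set (Matrix.GeneralLinearGroup (Fin m) k)) :
    Set (Matrix.GeneralLinearGroup (Fin m) k) :=
  ⋂₀ {Z | IsZariskiClosedGL Z ∧ X ⊆ Z}

section TrivialSummands

variable {k G : Type u} [Field k] [Monoid G]

theorem le_finrank_of_iso_trivial_biprod {V : Rep k G} [Module.Finite k V.V] {n : ℕ} {W : Rep k G}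
    (e : V ≅ Rep.trivial k G (Fin n → k) ⊞ W) : n ≤ Module.finrank k V.V := by
  let i : Rep.trivial k G (Fin n → k) ⟶ V := biprod.inl ≫ e.inv
  have hi : Function.Injective i.hom := (Rep.mono_iff_injective i).1 inferInstance
  simpa using LinearMap.finrank_le_finrank_of_injective (f := i.hom.toLinearMap) hi

theorem bddAbove_trivial_summands (V : Rep k G) [Module.Finite k V.V] :
    BddAbove {n : ℕ | ∃ W : Rep k G, Nonempty (V ≅ Rep.trivial k G (Fin n → k) ⊞ W)} :=
  ⟨Module.finrank k V.V, by rintro n ⟨W, ⟨e⟩⟩; exact le_finrank_of_iso_trivial_biprod e⟩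

theorem TS_le_finrank (V : Rep k G) [Module.Finite k V.V] : TS V ≤ Module.finrank k V.V := by
  by_cases h : {n : ℕ | ∃ W : Rep k G, Nonempty (V ≅ Rep.trivial k G (Fin n → k) ⊞ W)}.Nonempty
  · refine csSup_le h ?_
    rintro n ⟨W, ⟨e⟩⟩
    exact le_finrank_of_iso_trivial_biprod e
  · rw [TS, Set.not_nonempty_iff_eq_empty.1 h]
    simp

theorem le_TS_of_retract {V : Rep k G} [Module.Finite k V.V] {n : ℕ}
    (i : Rep.trivial k G (Fin n → k) ⟶ V) (p : V ⟶ Rep.trivial k G (Fin n → k))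
    (h : i ≫ p = 𝟙 _) : n ≤ TS V := by
  refine le_csSup (bddAbove_trivial_summands V) ?_
  have : IsSplitMono i := IsSplitMono.mk' ⟨p, h⟩
  exact ⟨cokernel i, ⟨biprod.uniqueUpToIso _ _
    (isBilimitBinaryBiconeOfIsSplitMonoOfCokernel (cokernelIsCokernel i))⟩⟩

/-- Invariant vectors and invariant functionals with an invertible pairing matrix split off a
trivial summand. -/
theorem le_TS_of_det_ne_zero {V : Rep k G} [Module.Finite k V.V] {n : ℕ}
    (x : Fin n → V.V) (φ : Fin n → V.V →ₗ[k] k) (hx : ∀ g j, V.ρ g (x j) = x j)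
    (hφ : ∀ g i y, φ i (V.ρ g y) = φ i y)
    (hdet : (Matrix.of fun i j => φ i (x j)).det ≠ 0) : n ≤ TS V := by
  set A : Matrix (Fin n) (Fin n) k := Matrix.of fun i j => φ i (x j) with hA
  let p : V.V →ₗ[k] (Fin n → k) := A⁻¹.mulVecLin ∘ₗ LinearMap.pi φ
  let i : (Fin n → k) →ₗ[k] V.V := Fintype.linearCombination k x
  refine le_TS_of_retract (V := V) (Rep.ofHom (σ := V.ρ) ⟨i, fun g => ?_⟩)
    (Rep.ofHom (ρ := V.ρ) ⟨p, fun g => ?_⟩) ?_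
  · refine LinearMap.ext fun c => ?_
    simp [i, Fintype.linearCombination_apply, hx]
  · refine LinearMap.ext fun y => ?_
    have : LinearMap.pi φ (V.ρ g y) = LinearMap.pi φ y := funext fun j => hφ g j y
    simp only [p, LinearMap.comp_apply, this]
    rfl
  · have key : p ∘ₗ i = LinearMap.id := by
      refine LinearMap.ext fun c => ?_
      have : LinearMap.pi φ (i c) = A.mulVec c := by
        funext j
        simp [i, Fintype.linearCombination_apply, hA, Matrix.mulVec, dotProduct, mul_comm]
      simp only [p, LinearMap.comp_apply, this, Matrix.mulVecLin_apply, Matrix.mulVec_mulVec,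
        Matrix.nonsing_inv_mul A (Ne.isUnit hdet), Matrix.one_mulVec, LinearMap.id_apply]
    exact Rep.hom_ext (DFunLike.ext _ _ fun c => LinearMap.congr_fun key c)

end TrivialSummands

section TensorPower

variable {k G : Type u} [Field k] [Monoid G] {m : ℕ}

theorem matRep_apply_apply (ρ : G →* Matrix.GeneralLinearGroup (Fin m) k) (g : G)
    (v : Fin m → k) : matRep ρ g v = (ρ g).val.mulVec v := rfl

theorem exists_basis_tpow_matRep (ρ : G →* Matrix.GeneralLinearGroup (Fin m) k) (n : ℕ) :
    ∃ b : Module.Basis (Fin n → Fin m) k (tpow (Rep.of (matRep ρ)) n).V,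
      ∀ g u v, b.repr ((tpow (Rep.of (matRep ρ)) n).ρ g (b v)) u
        = ∏ i, (ρ g).val (u i) (v i) := by
  induction n with
  | zero =>
    refine ⟨Module.Basis.singleton (Fin 0 → Fin m) k, fun g u v => ?_⟩
    change (Module.Basis.singleton (Fin 0 → Fin m) k).repr
      (Module.Basis.singleton (Fin 0 → Fin m) k v) u = _
    simp
  | succ n ih =>
    obtain ⟨b, hb⟩ := ih
    refine ⟨(b.tensorProduct (Pi.basisFun k (Fin m))).reindex
      ((Equiv.prodComm _ _).trans (Fin.snocEquiv fun _ => Fin m)), fun g u v => ?_⟩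
    change ((b.tensorProduct (Pi.basisFun k (Fin m))).reindex _).repr
      (TensorProduct.map ((tpow (Rep.of (matRep ρ)) n).ρ g) (matRep ρ g)
        ((b.tensorProduct (Pi.basisFun k (Fin m))).reindex _ v)) u = _
    rw [Module.Basis.repr_reindex_apply, Module.Basis.reindex_apply,
      Module.Basis.tensorProduct_apply', TensorProduct.map_tmul,
      Module.Basis.tensorProduct_repr_tmul_apply, hb, Fin.prod_univ_castSucc]
    simp [Fin.snocEquiv, matRep_apply_apply, Fin.init, mul_comm]

end TensorPower

section BlockTensor

variable {R : Type*} [CommRing R] {m : ℕ}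

/-- The sign of a self-map of `Fin m`: zero unless the map is a permutation. -/
def mapSign (R : Type*) [CommRing R] {m : ℕ} (f : Fin m → Fin m) : R :=
  ((1 : Matrix (Fin m) (Fin m) R).submatrix f id).det

theorem mapSign_id : mapSign R (id : Fin m → Fin m) = 1 := by
  simp [mapSign]

theorem injective_of_mapSign_ne_zero {f : Fin m → Fin m} (h : mapSign R f ≠ 0) :
    Function.Injective f := by
  intro i j hij
  by_contra hne
  exact h (Matrix.det_zero_of_row_eq hne (by ext l; rw [Matrix.submatrix_apply, hij]; rfl))

theorem map_mapSign {S : Type*} [CommRing S] (φ : R →+* S) (f : Fin m → Fin m) :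
    φ (mapSign R f) = mapSign S f := by
  simp only [mapSign, RingHom.map_det]
  congr 1
  ext i j
  simp [Matrix.one_apply, apply_ite φ]

theorem det_eq_sum_prod_mul_mapSign (A : Matrix (Fin m) (Fin m) R) :
    A.det = ∑ f : Fin m → Fin m, (∏ i, A i (f i)) * mapSign R f := by
  have h : A = fun i => ∑ j, A i j • (Pi.single j 1 : Fin m → R) := by
    ext i l
    simp [Finset.sum_apply, Pi.single_apply]
  conv_lhs => rw [h]
  change (Matrix.detRowAlternating (R := R)).toMultilinearMap _ = _
  rw [MultilinearMap.map_sum]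
  refine Finset.sum_congr rfl fun f _ => ?_
  rw [MultilinearMap.map_smul_univ, smul_eq_mul]
  congr 1
  change Matrix.det _ = Matrix.det _
  congr 1
  ext i j
  simp [Matrix.one_apply, Pi.single_apply, eq_comm]

theorem sum_prod_mul_mapSign (A : Matrix (Fin m) (Fin m) R) (u : Fin m → Fin m) :
    ∑ f : Fin m → Fin m, (∏ i, A (u i) (f i)) * mapSign R f = A.det * mapSign R u := by
  have h : A.submatrix u id = (1 : Matrix (Fin m) (Fin m) R).submatrix u id * A := by
    ext i j
    simp [Matrix.mul_apply, Matrix.one_apply]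
  have := det_eq_sum_prod_mul_mapSign (A.submatrix u id)
  rw [h, Matrix.det_mul, mul_comm] at this
  rw [mapSign, this, ← h]
  rfl

variable {P B : Type*} [Fintype B]

/-- The coefficients of a product of determinant tensors, one for each block of positions. -/
def blockTensor (R : Type*) [CommRing R] (E : B × Fin m ≃ P) (u : P → Fin m) : R :=
  ∏ b, mapSign R fun a => u (E (b, a))

theorem map_blockTensor {S : Type*} [CommRing S] (φ : R →+* S) (E : B × Fin m ≃ P)
    (u : P → Fin m) : φ (blockTensor R E u) = blockTensor S E u := by
  simp [blockTensor, map_mapSign]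

variable [Fintype P] [DecidableEq P] [DecidableEq B]

theorem sum_prod_mul_blockTensor (A : Matrix (Fin m) (Fin m) R) (E : B × Fin m ≃ P)
    (u : P → Fin m) :
    ∑ v : P → Fin m, (∏ p, A (u p) (v p)) * blockTensor R E v
      = A.det ^ Fintype.card B * blockTensor R E u := by
  let e : (P → Fin m) ≃ (B → Fin m → Fin m) :=
    (Equiv.arrowCongr E.symm (Equiv.refl _)).trans (Equiv.curry _ _ _)
  have he : ∀ v b a, e v b a = v (E (b, a)) := fun v b a => rfl
  have hterm : ∀ v : P → Fin m, (∏ p, A (u p) (v p)) * blockTensor R E v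
      = ∏ b, ((∏ a, A (u (E (b, a))) (e v b a)) * mapSign R (e v b)) := by
    intro v
    rw [Finset.prod_mul_distrib, ← Fintype.prod_prod_type'
      (fun b a => A (u (E (b, a))) (e v b a)), ← E.prod_comp]
    rfl
  rw [Fintype.sum_congr _ _ hterm, e.sum_comp
    (fun w => ∏ b, ((∏ a, A (u (E (b, a))) (w b a)) * mapSign R (w b)))]
  rw [← Fintype.prod_sum (fun b (f : Fin m → Fin m) =>
    (∏ a, A (u (E (b, a))) (f a)) * mapSign R f)]
  simp_rw [sum_prod_mul_mapSign A]
  rw [Finset.prod_mul_distrib, Finset.prod_const, Finset.card_univ, blockTensor]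

theorem sum_blockTensor_mul_prod (A : Matrix (Fin m) (Fin m) R) (E : B × Fin m ≃ P)
    (v : P → Fin m) :
    ∑ u : P → Fin m, blockTensor R E u * (∏ p, A (u p) (v p))
      = A.det ^ Fintype.card B * blockTensor R E v := by
  simpa [mul_comm] using sum_prod_mul_blockTensor A.transpose E v

end BlockTensor

section OrderedBlocks

variable {m : ℕ} {P B : Type*} [LinearOrder P] [Fintype B]

/-- A word reads `0, 1, …, m - 1` along each block of positions. -/
def IsBlockReading (E : B × Fin m ≃ P) (w : P → Fin m) : Prop :=
  (∀ b a, w (E (b, a)) = a) ∧ ∀ b, StrictMono fun a => E (b, a)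

theorem IsBlockReading.blockTensor_self {R : Type*} [CommRing R] {E : B × Fin m ≃ P}
    {w : P → Fin m} (h : IsBlockReading E w) : blockTensor R E w = 1 := by
  refine Finset.prod_eq_one fun b _ => ?_
  rw [show (fun a => w (E (b, a))) = id from funext (h.1 b), mapSign_id]

variable [Fintype P]

theorem IsBlockReading.le_of_blockTensor_ne_zero {R : Type*} [CommRing R]
    {E : B × Fin m ≃ P} {w u : P → Fin m} (h : IsBlockReading E w)
    (hu : blockTensor R E u ≠ 0) : toLex w ≤ toLex u := by
  by_contra hlt
  rw [not_le] at hlt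
  obtain ⟨p, hp, hup⟩ := hlt
  obtain ⟨⟨b, a⟩, rfl⟩ := E.surjective p
  simp only [Pi.toLex_apply] at hp hup
  rw [h.1] at hup
  have hinj : Function.Injective fun a => u (E (b, a)) := by
    refine injective_of_mapSign_ne_zero (R := R) fun h0 => hu ?_
    exact Finset.prod_eq_zero (Finset.mem_univ b) h0
  have h1 : u (E (b, u (E (b, a)))) = u (E (b, a)) := by
    rw [hp _ (h.2 b hup), h.1]
  exact hup.ne (hinj h1)

/-- The Gram matrix of the block tensors attached to a family of block decompositions. -/
def blockGram (R : Type*) [CommRing R] {N : ℕ} (E : Fin N → (B × Fin m ≃ P)) :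
    Matrix (Fin N) (Fin N) R :=
  Matrix.of fun i j => ∑ u, blockTensor R (E i) u * blockTensor R (E j) u

theorem intCast_det_blockGram (R : Type*) [CommRing R] {N : ℕ} (E : Fin N → (B × Fin m ≃ P)) :
    ((blockGram ℤ E).det : R) = (blockGram R E).det := by
  rw [← eq_intCast (Int.castRingHom R), RingHom.map_det]
  congr 1
  ext i j
  simp only [RingHom.mapMatrix_apply, Matrix.map_apply, blockGram, Matrix.of_apply, map_sum,
    map_mul, map_blockTensor]

/-- The block tensors of distinct words, each read along its own blocks, have an invertible Gram
matrix. -/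
theorem det_gram_blockTensor_ne_zero {k : Type*} [Field k] [CharZero k] {N : ℕ}
    (w : Fin N → P → Fin m) (hw : Function.Injective w) (E : Fin N → (B × Fin m ≃ P))
    (hE : ∀ i, IsBlockReading (E i) (w i)) :
    (blockGram k E).det ≠ 0 := by
  have hli : LinearIndependent ℚ fun i => blockTensor ℚ (E i) := by
    rw [Fintype.linearIndependent_iff]
    intro c hc
    by_contra! hne
    obtain ⟨i₀, hi₀⟩ := hne
    obtain ⟨i, hi, hmin⟩ := Finset.exists_min_image (Finset.univ.filter fun i => c i ≠ 0)
      (fun i => toLex (w i)) ⟨i₀, by simpa using hi₀⟩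
    have hsum := congrFun hc (w i)
    rw [Finset.sum_apply, Finset.sum_eq_single i] at hsum
    · simp only [Pi.smul_apply, (hE i).blockTensor_self, smul_eq_mul, mul_one,
        Pi.zero_apply] at hsum
      simp [hsum] at hi
    · intro j _ hji
      by_cases hj : c j = 0
      · simp [hj]
      · have h1 := hmin j (by simpa using hj)
        have h2 : blockTensor ℚ (E j) (w i) = 0 := by
          by_contra h0
          have h3 := (hE j).le_of_blockTensor_ne_zero h0
          exact hji (hw (toLex.injective (le_antisymm h3 h1)))
        simp [h2]
    · simp
  have hQ : (blockGram ℚ E).det ≠ 0 := by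
    intro h0
    obtain ⟨c, hc, hcz⟩ := Matrix.exists_mulVec_eq_zero_iff.2 h0
    have hsq : ∑ u, (∑ i, c i * blockTensor ℚ (E i) u) ^ 2 = 0 := by
      have : dotProduct c ((blockGram ℚ E).mulVec c) = 0 := by rw [hcz, dotProduct_zero]
      rw [← this]
      simp only [dotProduct, Matrix.mulVec, blockGram, Matrix.of_apply, Finset.mul_sum, Finset.sum_mul,
        sq]
      rw [Finset.sum_comm]
      conv_lhs => enter [2, i]; rw [Finset.sum_comm]
      refine Finset.sum_congr rfl fun i _ => Finset.sum_congr rfl fun j _ =>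
        Finset.sum_congr rfl fun u _ => by ring
    rw [Finset.sum_eq_zero_iff_of_nonneg fun u _ => sq_nonneg _] at hsq
    refine hc (funext ((Fintype.linearIndependent_iff.1 hli) c (funext fun u => ?_)))
    simpa using hsq u (Finset.mem_univ u)
  have hZ : (blockGram ℤ E).det ≠ 0 := fun h0 => hQ (by rw [← intCast_det_blockGram ℚ, h0, Int.cast_zero])
  rw [← intCast_det_blockGram k]
  exact_mod_cast hZ

end OrderedBlocks

section BlockWords

/-- Words of length `n` that can be cut into `s` blocks, each reading `0, 1, …, m - 1`. -/
def blockWords (m n s : ℕ) : Set (Fin n → Fin m) :=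
  {w | ∃ E : Fin s × Fin m ≃ Fin n, IsBlockReading E w}

theorem ncard_blockWords_le_TS {k G : Type u} [Field k] [CharZero k] [Monoid G] {m : ℕ}
    (ρ : G →* Matrix.GeneralLinearGroup (Fin m) k) (n s : ℕ)
    (hdet : ∀ g, (ρ g).val.det ^ s = 1) :
    (blockWords m n s).ncard ≤ TS (tpow (Rep.of (matRep ρ)) n) := by
  obtain ⟨b, hb⟩ := exists_basis_tpow_matRep ρ n
  have : Module.Finite k (tpow (Rep.of (matRep ρ)) n).V := Module.Finite.of_basis b
  set N := (blockWords m n s).ncard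
  let e : blockWords m n s ≃ Fin N := Finite.equivFinOfCardEq rfl
  choose E hE using fun w : blockWords m n s => w.2
  let F : Fin N → (Fin s × Fin m ≃ Fin n) := fun i => E (e.symm i)
  have hgram := det_gram_blockTensor_ne_zero (k := k) (fun i => (e.symm i : Fin n → Fin m))
    (Subtype.val_injective.comp e.symm.injective) F fun i => hE _
  have hρ : ∀ g y u, b.repr ((tpow (Rep.of (matRep ρ)) n).ρ g y) u
      = ∑ v, (∏ i, (ρ g).val (u i) (v i)) * b.repr y v := by
    intro g y u
    conv_lhs => rw [← b.sum_repr y, map_sum, map_sum, Finsupp.finsetSum_apply]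
    refine Finset.sum_congr rfl fun v _ => ?_
    rw [map_smul, map_smul, Finsupp.smul_apply, hb, smul_eq_mul, mul_comm]
  refine le_TS_of_det_ne_zero (fun j => b.equivFun.symm (blockTensor k (F j)))
    (fun i => ∑ u, blockTensor k (F i) u • b.coord u) ?_ ?_ ?_
  · intro g j
    refine b.repr.injective (Finsupp.ext fun u => ?_)
    have hr : ∀ v, b.repr (b.equivFun.symm (blockTensor k (F j))) v = blockTensor k (F j) v :=
      fun v => congrFun (b.equivFun.apply_symm_apply (blockTensor k (F j))) v
    rw [hρ]
    simp_rw [hr]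
    rw [sum_prod_mul_blockTensor, Fintype.card_fin, hdet, one_mul]
  · intro g i y
    simp only [LinearMap.sum_apply, LinearMap.smul_apply, Module.Basis.coord_apply, smul_eq_mul,
      hρ, Finset.mul_sum]
    rw [Finset.sum_comm]
    refine Finset.sum_congr rfl fun v _ => ?_
    simp_rw [← mul_assoc]
    rw [← Finset.sum_mul, sum_blockTensor_mul_prod, Fintype.card_fin, hdet, one_mul]
  · convert hgram using 2
    ext i j
    have hr : ∀ v, b.repr (b.equivFun.symm (blockTensor k (F j))) v = blockTensor k (F j) v :=
      fun v => congrFun (b.equivFun.apply_symm_apply (blockTensor k (F j))) v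
    simp only [LinearMap.sum_apply, LinearMap.smul_apply, Module.Basis.coord_apply, smul_eq_mul,
      Matrix.of_apply, blockGram, hr]

end BlockWords

section Counting

open scoped Nat

theorem card_perm_comp_eq {α ι : Type*} [DecidableEq α] [Fintype α] [DecidableEq ι] [Fintype ι]
    (f : α → ι) :
    (Finset.univ.filter fun π : Equiv.Perm α => f ∘ π = f).card
      = ∏ i, (Fintype.card {a // f a = i})! := by
  rw [← DomMulAct.stabilizer_card f, Fintype.card_subtype]

/-- Permuting the positions of equal time in `r` staggered families of `q` blocks produces many
words that can be cut into blocks. -/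
theorem factorial_pow_le_ncard_blockWords (m q r : ℕ) :
    ((m * q)!) ^ (r + 1 - m) ≤ (q !) ^ (m * r) * (blockWords m (m * q * r) (r * q)).ncard := by
  classical
  let P := (Fin r × Fin q) × Fin m
  let t : P → Fin (r + m) := fun p => ⟨p.1.1 + p.2, by omega⟩
  have hcard : Fintype.card P = m * q * r := by simp [P]; ring
  let e₀ : P ≃ Fin (m * q * r) := Fintype.equivFinOfCardEq hcard
  let e : Fin (m * q * r) ≃ P := (Tuple.sort (t ∘ e₀.symm)).trans e₀.symm
  have he : Monotone (t ∘ e) := Tuple.monotone_sort (t ∘ e₀.symm)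
  let S : Finset (Equiv.Perm P) := Finset.univ.filter fun π => t ∘ π = t
  let word : Equiv.Perm P → Fin (m * q * r) → Fin m := fun π x => (π (e x)).2
  have hword : ((S.image word : Finset _) : Set _) ⊆ blockWords m (m * q * r) (r * q) := by
    intro w hw
    simp only [Finset.coe_image, Set.mem_image, Finset.mem_coe] at hw
    obtain ⟨π, hπ, rfl⟩ := hw
    have hπ : t ∘ π = t := by simpa [S] using hπ
    have hsymm : ∀ p, t (π.symm p) = t p := fun p => by
      conv_rhs => rw [← π.apply_symm_apply p]
      exact (congrFun hπ _).symm
    refine ⟨(Equiv.prodCongr finProdFinEquiv.symm (Equiv.refl _)).trans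
      (π.symm.trans e.symm), fun b a => by simp [word], fun b a a' haa' => ?_⟩
    refine he.reflect_lt ?_
    simp only [Equiv.trans_apply, Function.comp_apply, Equiv.apply_symm_apply, hsymm]
    simpa [t] using haa'
  have hfib : ∀ w ∈ S.image word, (S.filter fun π => word π = w).card ≤ (q !) ^ (m * r) := by
    intro w hw
    obtain ⟨π₀, hπ₀, rfl⟩ := Finset.mem_image.1 hw
    have hπ₀ : t ∘ π₀ = t := by simpa [S] using hπ₀
    let f : P → Fin r × Fin m := fun p => (p.1.1, p.2)
    have hf : (Finset.univ.filter fun π : Equiv.Perm P => f ∘ π = f).card = (q !) ^ (m * r) := by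
      rw [card_perm_comp_eq, Finset.prod_congr rfl fun i _ => ?_, Finset.prod_const,
        Finset.card_univ, Fintype.card_prod, Fintype.card_fin, Fintype.card_fin, mul_comm r m]
      congr 1
      refine (Fintype.card_congr ?_).trans (Fintype.card_fin q)
      exact
        { toFun := fun p => p.1.1.2
          invFun := fun j => ⟨((i.1, j), i.2), rfl⟩
          left_inv := by rintro ⟨⟨⟨a, b⟩, c⟩, rfl⟩; rfl
          right_inv := fun j => rfl }
    rw [← hf]
    refine Finset.card_le_card_of_injOn (fun π => π₀.symm.trans π) ?_ ?_
    · intro π hπ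
      simp only [S, Finset.coe_filter, Finset.mem_filter, Finset.mem_univ, true_and,
        Set.mem_ofPred_eq] at hπ ⊢
      obtain ⟨h1, h2⟩ := hπ
      funext p
      obtain ⟨p, rfl⟩ := π₀.surjective p
      have h3 := congrFun h2 (e.symm p)
      have h4 : (t (π p)).val = (t (π₀ p)).val := by
        rw [← Function.comp_apply (f := t), ← Function.comp_apply (f := t) (g := π₀), h1, hπ₀]
      simp only [word, Equiv.apply_symm_apply] at h3
      simp only [t, h3] at h4
      simp only [f, Function.comp_apply, Equiv.trans_apply, Equiv.symm_apply_apply, h3,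
        Prod.mk.injEq, and_true]
      exact Fin.ext (by omega)
    · intro π _ π' _ h
      ext1 p
      simpa using Equiv.congr_fun h (π₀ p)
  have hS : ((m * q)!) ^ (r + 1 - m) ≤ S.card := by
    rw [card_perm_comp_eq]
    rcases Nat.eq_zero_or_pos m with rfl | hm
    · simp
    let g : Fin (r + 1 - m) → Fin (r + m) := fun i => ⟨i + (m - 1), by omega⟩
    have hg : Function.Injective g := fun i j h => by
      simp only [g, Fin.mk.injEq] at h
      exact Fin.ext (by omega)
    calc ((m * q)!) ^ (r + 1 - m)
        = ∏ _i : Fin (r + 1 - m), (m * q)! := by simp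
      _ ≤ ∏ i, (Fintype.card {p // t p = g i})! := by
          refine Finset.prod_le_prod' fun i _ => Nat.factorial_le ?_
          refine (show m * q = Fintype.card (Fin m × Fin q) by simp).le.trans ?_
          refine Fintype.card_le_of_injective (fun x : Fin m × Fin q =>
            (⟨((⟨i + (m - 1) - x.1, by omega⟩, x.2), x.1), Fin.ext ?_⟩ :
              {p : P // t p = g i})) ?_
          · simp only [t, g]
            omega
          · rintro ⟨a, j⟩ ⟨a', j'⟩ h
            have h := congrArg Subtype.val h
            exact Prod.ext (congrArg Prod.snd h) (congrArg (fun p => p.1.2) h)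
      _ = ∏ i ∈ Finset.univ.map ⟨g, hg⟩, (Fintype.card {p // t p = i})! := by
          rw [Finset.prod_map]; rfl
      _ ≤ _ := Finset.prod_le_prod_of_subset_of_one_le' (Finset.subset_univ _)
          fun i _ _ => Nat.succ_le_of_lt (Nat.factorial_pos _)
  calc ((m * q)!) ^ (r + 1 - m) ≤ S.card := hS
    _ ≤ (q !) ^ (m * r) * (S.image word).card := Finset.card_le_mul_card_image _ _ hfib
    _ ≤ _ := by
      gcongr
      rw [← Set.ncard_coe_finset]
      exact Set.ncard_le_ncard hword (Set.toFinite _)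

end Counting

section Growth

open Filter
open scoped Nat

theorem exists_mul_pow_factorial_lt {m : ℕ} {c : ℝ} (hc : 0 < c) (hcm : c < m) :
    ∃ q : ℕ, 0 < q ∧ c ^ (m * q) * (q ! : ℝ) ^ m < ((m * q)! : ℝ) := by
  have hm : 0 < m := by exact_mod_cast hc.trans hcm
  have hm' : (0 : ℝ) < m := by exact_mod_cast hm
  have hx : 1 < (m : ℝ) / c := (one_lt_div hc).2 hcm
  have hlim := tendsto_pow_const_div_const_pow_of_one_lt 1 hx
  obtain ⟨q, hq1, hq⟩ := ((hlim.eventually_lt_const (inv_pos.2 (Real.exp_pos 1))).and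
    (eventually_gt_atTop 0)).exists
  refine ⟨q, hq, ?_⟩
  have hq' : (0 : ℝ) < q := by exact_mod_cast hq
  have hq1 : Real.exp 1 * q < ((m : ℝ) / c) ^ q := by
    rw [pow_one, div_lt_iff₀ (by positivity), inv_mul_eq_div, lt_div_iff₀ (Real.exp_pos 1)] at hq1
    linarith
  have hupper : (q ! : ℝ) ≤ Real.exp 1 * q * (q / Real.exp 1) ^ q := by
    obtain ⟨n, rfl⟩ := Nat.exists_eq_succ_of_ne_zero hq.ne'
    have h := Stirling.stirlingSeq'_antitone (Nat.zero_le n)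
    simp only [Function.comp_apply, Nat.succ_eq_add_one, zero_add, Stirling.stirlingSeq_one] at h
    rw [Stirling.stirlingSeq, div_le_iff₀ (by positivity)] at h
    refine h.trans ?_
    rw [← mul_assoc]
    refine mul_le_mul_of_nonneg_right ?_ (by positivity)
    rw [Real.sqrt_mul zero_le_two, ← mul_assoc, div_mul_cancel₀ _ (by positivity)]
    refine mul_le_mul_of_nonneg_left ?_ (Real.exp_pos 1).le
    refine Real.sqrt_le_iff.2 ⟨by positivity, ?_⟩
    have : (1 : ℝ) ≤ ((n + 1 : ℕ) : ℝ) := by exact_mod_cast Nat.succ_pos n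
    nlinarith
  have hlower : (((m * q : ℕ) : ℝ) / Real.exp 1) ^ (m * q) ≤ ((m * q)! : ℝ) := by
    refine le_trans ?_ (Stirling.le_factorial_stirling (m * q))
    refine le_mul_of_one_le_left (by positivity) (Real.one_le_sqrt.2 ?_)
    have h1 : (1 : ℝ) ≤ ((m * q : ℕ) : ℝ) := by exact_mod_cast Nat.mul_pos hm hq
    nlinarith [Real.pi_gt_three]
  refine lt_of_lt_of_le ?_ hlower
  rw [mul_comm m q, pow_mul, pow_mul, ← mul_pow]
  refine pow_lt_pow_left₀ ?_ (by positivity) hm.ne'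
  calc c ^ q * (q ! : ℝ) ≤ c ^ q * (Real.exp 1 * q * (q / Real.exp 1) ^ q) := by gcongr
    _ < c ^ q * ((m / c) ^ q * (q / Real.exp 1) ^ q) := by gcongr
    _ = (((q * m : ℕ) : ℝ) / Real.exp 1) ^ q := by
      rw [← mul_pow, ← mul_pow]
      congr 1
      push_cast
      field_simp

theorem frequently_pow_le_ncard_blockWords {m K : ℕ} (hK : 0 < K) {c : ℝ} (hc : 0 < c)
    (hcm : c < m) :
    ∃ᶠ n in atTop, ∃ s, K ∣ s ∧ c ^ n ≤ ((blockWords m n s).ncard : ℝ) := by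
  obtain ⟨q, hq, hlt⟩ := exists_mul_pow_factorial_lt hc hcm
  have hm : 0 < m := by exact_mod_cast hc.trans hcm
  set A : ℝ := ((m * q)! : ℝ) with hA
  set D : ℝ := c ^ (m * q) * (q ! : ℝ) ^ m with hD
  have hq0 : (0 : ℝ) < (q ! : ℝ) := by exact_mod_cast Nat.factorial_pos q
  have hD0 : 0 < D := by positivity
  have hA1 : 1 ≤ A := by
    rw [hA]
    exact_mod_cast Nat.factorial_pos (m * q)
  have hev : ∀ᶠ r : ℕ in atTop, A ^ m ≤ (A / D) ^ r :=
    (tendsto_pow_atTop_atTop_of_one_lt ((one_lt_div hD0).2 hlt)).eventually_ge_atTop _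
  have hmul : Tendsto (fun j : ℕ => K * j) atTop atTop := tendsto_id.const_mul_atTop' hK
  rw [frequently_atTop]
  intro n₀
  obtain ⟨j, hj, hjn⟩ := ((hmul.eventually hev).and (hmul.eventually_ge_atTop n₀)).exists
  set r := K * j
  refine ⟨m * q * r, hjn.trans (Nat.le_mul_of_pos_left _ (Nat.mul_pos hm hq)), r * q,
    Dvd.dvd.mul_right (Dvd.intro j rfl) q, ?_⟩
  have h1 : A ^ (r + 1 - m) ≤ (q ! : ℝ) ^ (m * r) * ((blockWords m (m * q * r) (r * q)).ncard : ℝ) := by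
    rw [hA]
    exact_mod_cast factorial_pow_le_ncard_blockWords m q r
  have h2 : D ^ r ≤ A ^ (r + 1 - m) := by
    rw [div_pow, le_div_iff₀ (by positivity)] at hj
    have h3 : A ^ r ≤ A ^ m * A ^ (r + 1 - m) := by
      rw [← pow_add]
      exact pow_le_pow_right₀ hA1 (by omega)
    exact le_of_mul_le_mul_left (hj.trans h3) (by positivity)
  have h4 : D ^ r = (q ! : ℝ) ^ (m * r) * c ^ (m * q * r) := by
    rw [hD, mul_pow, ← pow_mul, ← pow_mul, mul_comm]
  rw [h4] at h2
  exact le_of_mul_le_mul_left (h2.trans h1) (by positivity)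

theorem TS_tpow_matRep_le {k G : Type u} [Field k] [Monoid G] {m : ℕ}
    (ρ : G →* Matrix.GeneralLinearGroup (Fin m) k) (n : ℕ) :
    TS (tpow (Rep.of (matRep ρ)) n) ≤ m ^ n := by
  obtain ⟨b, -⟩ := exists_basis_tpow_matRep ρ n
  have : Module.Finite k (tpow (Rep.of (matRep ρ)) n).V := Module.Finite.of_basis b
  refine (TS_le_finrank _).trans ?_
  rw [Module.finrank_eq_card_basis b]
  simp

theorem dG_matRep_eq {k G : Type u} [Field k] [CharZero k] [Monoid G] {m K : ℕ} (hK : 0 < K)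
    (ρ : G →* Matrix.GeneralLinearGroup (Fin m) k) (hdet : ∀ g, (ρ g).val.det ^ K = 1) :
    dG (Rep.of (matRep ρ)) = (m : ℝ) := by
  set f : ℕ → ℝ := fun n => (TS (tpow (Rep.of (matRep ρ)) n) : ℝ) ^ ((n : ℝ)⁻¹)
  have hf0 : ∀ n, 0 ≤ f n := fun n => by positivity
  have hle : ∀ᶠ n in atTop, f n ≤ m := by
    filter_upwards [eventually_gt_atTop 0] with n hn
    calc f n ≤ ((m : ℝ) ^ n) ^ ((n : ℝ)⁻¹) := by
          refine Real.rpow_le_rpow (by positivity) ?_ (by positivity)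
          exact_mod_cast TS_tpow_matRep_le ρ n
      _ = m := Real.pow_rpow_inv_natCast (by positivity) hn.ne'
  have hbdd : IsBoundedUnder (· ≤ ·) atTop f := ⟨m, hle⟩
  have hcobdd : IsCoboundedUnder (· ≤ ·) atTop f :=
    IsBoundedUnder.isCoboundedUnder_le ⟨0, eventually_map.2 (Eventually.of_forall hf0)⟩
  change limsup f atTop = m
  refine le_antisymm (limsup_le_of_le hcobdd hle) (le_of_forall_lt_imp_le_of_dense fun c hcm => ?_)
  refine le_limsup_of_frequently_le ?_ hbdd
  rcases le_or_gt c 0 with hc | hc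
  · exact Frequently.of_forall fun n => hc.trans (hf0 n)
  · refine ((frequently_pow_le_ncard_blockWords hK hc hcm).and_eventually
      (eventually_gt_atTop 0)).mono ?_
    rintro n ⟨⟨s, ⟨j, rfl⟩, hs⟩, hn⟩
    have h1 : c ^ n ≤ (TS (tpow (Rep.of (matRep ρ)) n) : ℝ) :=
      hs.trans (Nat.cast_le.2 (ncard_blockWords_le_TS ρ n (K * j)
        fun g => by rw [pow_mul, hdet, one_pow]))
    calc c = (c ^ n) ^ ((n : ℝ)⁻¹) := (Real.pow_rpow_inv_natCast hc.le hn.ne').symm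
      _ ≤ f n := Real.rpow_le_rpow (by positivity) h1 (by positivity)

theorem exists_pow_det_eq_one_of_finite {k : Type*} [Field k] {m : ℕ}
    (G : Subgroup (Matrix.GeneralLinearGroup (Fin m) k))
    (hfin : ((fun g : Matrix.GeneralLinearGroup (Fin m) k => Matrix.det g.val) ''
        (G : Set (Matrix.GeneralLinearGroup (Fin m) k))).Finite) :
    ∃ K : ℕ, 0 < K ∧ ∀ g : G, (g : Matrix.GeneralLinearGroup (Fin m) k).val.det ^ K = 1 := by
  let H : Subgroup kˣ := G.map Matrix.GeneralLinearGroup.det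
  have hH : (H : Set kˣ).Finite := by
    refine Set.Finite.of_finite_image (f := Units.val) ?_ Units.val_injective.injOn
    simpa [H, Set.image_image] using hfin
  have : Finite H := hH
  refine ⟨Nat.card H, Nat.card_pos, fun g => ?_⟩
  have h := pow_card_eq_one' (x := (⟨_, Subgroup.mem_map_of_mem _ g.2⟩ : H))
  exact congrArg (fun x : H => ((x : kˣ) : k)) h

end Growth

/-- **Proposition.** If `G` is a closed subgroup of `GL_m(k)` (`k` algebraically closed of
characteristic `0`) on which the determinant takes finitely many values, then `d(G, V) = m`. -/
theorem dG_eq_dim_of_det_finite {k : Type u} [Field k] [IsAlgClosed k] [CharZero k] {m : ℕ}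
    (G : Subgroup (Matrix.GeneralLinearGroup (Fin m) k))
    (hclosed : IsZariskiClosedGL (G : Set (Matrix.GeneralLinearGroup (Fin m) k)))
    (hfin : ((fun g : Matrix.GeneralLinearGroup (Fin m) k => Matrix.det g.val) ''
        (G : Set (Matrix.GeneralLinearGroup (Fin m) k))).Finite) :
    dG (Rep.of (matRep G.subtype)) = (m : ℝ) := by
  obtain ⟨K, hK, hdet⟩ := exists_pow_det_eq_one_of_finite G hfin
  exact dG_matRep_eq hK G.subtype hdet
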